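/- Suppose 0 ≤ m ≤ ℓ ≤ n with ℓ + m < n and the operator S^{ℓ,m}_{[0,n−1]} commutes with D_n. Then S^{ℓ,m}_{[0,n−1]} is a constant multiple of the identity; moreover, if ℓ − m is odd then S^{ℓ,m}_{[0,n−1]} = 0. -/

import Mathlib

noncomputable section

abbrev Hqw : Type := lp (fun _ : ℤ => ℂ) 2
abbrev Op : Type := Hqw →L[ℂ] Hqw

noncomputable def δ (j : ℤ) : Hqw := lp.single 2 j 1

def coord (ψ : Hqw) (i : ℤ) : ℂ := ψ i

/-- `B δ_j = δ_{j-1} - δ_{j+1}`. -/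
def IsB (B : Op) : Prop := ∀ j : ℤ, B (δ j) = δ (j - 1) - δ (j + 1)

/-- `C δ_{2j} = δ_{2j+2}`, `C δ_{2j+1} = δ_{2j-1}`. -/
def IsC (C : Op) : Prop :=
  ∀ j : ℤ, C (δ (2 * j)) = δ (2 * j + 2) ∧ C (δ (2 * j + 1)) = δ (2 * j - 1)

/-- the position sequence: `x_{2j} = x_{2j+1} = |j|`. -/
def IsPos (x : ℤ → ℝ) : Prop :=
  ∀ j : ℤ, x (2 * j) = |(j : ℝ)| ∧ x (2 * j + 1) = |(j : ℝ)|

/-- `K` is the commutator `[X, A]`, i.e. `⟨δ_i, K δ_j⟩ = (x_i - x_j) ⟨δ_i, A δ_j⟩`. -/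
def IsXComm (x : ℤ → ℝ) (A K : Op) : Prop :=
  ∀ i j : ℤ, coord (K (δ j)) i = ((x i - x j : ℝ) : ℂ) * coord (A (δ j)) i

/-- a local field: a diagonal unitary `D δ_j = e^{iθ_j} δ_j`. -/
def IsLocalField (D : Op) : Prop :=
  ∃ θ : ℤ → ℝ, ∀ j : ℤ, D (δ j) = Complex.exp ((θ j : ℂ) * Complex.I) • δ j

/-- `U_t = r² I + r t B + t² C` with `r = √(1 - t²)`. -/
def Ut (t : ℝ) (B C : Op) : Op :=
  (((Real.sqrt (1 - t ^ 2)) ^ 2 : ℝ) : ℂ) • (1 : Op) +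
    ((Real.sqrt (1 - t ^ 2) * t : ℝ) : ℂ) • B + ((t ^ 2 : ℝ) : ℂ) • C

/-- `⟨X⟩_ψ = Σ_j x_j |⟨δ_j, ψ⟩|²`. -/
def Xexp (x : ℤ → ℝ) (ψ : Hqw) : ℝ := ∑' j : ℤ, x j * ‖coord ψ j‖ ^ 2

/-- a unit vector supported on `span{δ₀, δ₁}`. -/
def IsInit (Ψ : Hqw) : Prop := ‖Ψ‖ = 1 ∧ ∃ a b : ℂ, Ψ = a • δ 0 + b • δ 1

/-- `α = e^{2πik/n}` with `k ∈ ℤ⁺`, `gcd(k,n) = 1`, `α ≠ 1`. -/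
def IsAdmissible (n : ℕ) (α : ℂ) : Prop :=
  α ≠ 1 ∧ ∃ k : ℕ, 0 < k ∧ Nat.gcd k n = 1 ∧
    α = Complex.exp (((2 * Real.pi * k / n : ℝ) : ℂ) * Complex.I)

/-- the `n`-periodic field `D_n δ_j = α^j δ_j`. -/
def IsDn (α : ℂ) (D : Op) : Prop := ∀ j : ℤ, D (δ j) = α ^ j • δ j

/-- `B^{(j)} = D_n^j B D_n^{-j}`, explicitly `B^{(j)} δ_i = α^{-j} δ_{i-1} - α^{j} δ_{i+1}`. -/
def IsBj (α : ℂ) (j : ℤ) (Bj : Op) : Prop :=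
  ∀ i : ℤ, Bj (δ i) = α ^ (-j) • δ (i - 1) - α ^ j • δ (i + 1)

/-- `C^{(j)} = D_n^j C D_n^{-j}`, explicitly `C^{(j)} δ_{2i} = α^{2j} δ_{2i+2}`,
`C^{(j)} δ_{2i+1} = α^{-2j} δ_{2i-1}`. -/
def IsCj (α : ℂ) (j : ℤ) (Cj : Op) : Prop :=
  ∀ i : ℤ, Cj (δ (2 * i)) = α ^ (2 * j) • δ (2 * i + 2) ∧
    Cj (δ (2 * i + 1)) = α ^ (-(2 * j)) • δ (2 * i - 1)

-- the elementary symmetric polynomial of operators `S^{ℓ,m}_{[a, n-1]}`: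
-- sum over `a ≤ j₁ < … < j_ℓ ≤ n-1` and `η ∈ {0,1}^ℓ` with `|η| = m` of the ordered
-- products `A_{η₁}^{(j₁)} ⋯ A_{η_ℓ}^{(j_ℓ)}`, where `A_1 = C`, `A_0 = B`.
open Classical in
noncomputable def Sop (Bf Cf : ℤ → Op) (a n ℓ m : ℕ) : Op :=
  ∑ p : (Fin ℓ → Fin n) × (Fin ℓ → Bool),
    if StrictMono p.1 ∧ (∀ k, a ≤ (p.1 k : ℕ)) ∧
        (Finset.univ.filter fun k => p.2 k = true).card = m then
      (List.ofFn fun k : Fin ℓ =>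
        if p.2 k = true then Cf ((p.1 k : ℕ) : ℤ) else Bf ((p.1 k : ℕ) : ℤ)).prod
    else 0

theorem op_mul (A B : Op) (v : Hqw) : (A * B) v = A (B v) := rfl

/-- two operators/functionals which agree on the basis agree -/
theorem clm_ext_delta {F : Type*} [NormedAddCommGroup F] [NormedSpace ℂ F]
    {f g : Hqw →L[ℂ] F} (h : ∀ j, f (δ j) = g (δ j)) : f = g := by
  refine lp.ext_continuousLinearMap (ENNReal.ofNat_ne_top (n := nat_lit 2)) fun i => ?_
  ext
  simpa [δ] using h i

def coordL (i : ℤ) : Hqw →L[ℂ] ℂ := lp.evalCLM ℂ (fun _ : ℤ => ℂ) 2 i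

theorem coordL_apply (i : ℤ) (v : Hqw) : coordL i v = coord v i := rfl

theorem coord_delta (j i : ℤ) : coord (δ j) i = if i = j then 1 else 0 := by
  unfold coord δ
  rw [lp.single_apply, Pi.single_apply]

theorem coord_add (u v : Hqw) (i : ℤ) : coord (u + v) i = coord u i + coord v i := rfl
theorem coord_sub (u v : Hqw) (i : ℤ) : coord (u - v) i = coord u i - coord v i := rfl
theorem coord_smul (c : ℂ) (v : Hqw) (i : ℤ) : coord (c • v) i = c * coord v i := rfl

theorem coord_ext {u v : Hqw} (h : ∀ i, coord u i = coord v i) : u = v := by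
  apply lp.ext
  funext i
  exact h i

theorem coord_B {α : ℂ} {a : ℤ} {B : Op} (hB : IsBj α a B) (v : Hqw) (i : ℤ) :
    coord (B v) i = α ^ (-a) * coord v (i + 1) - α ^ a * coord v (i - 1) := by
  have : (coordL i).comp B = α ^ (-a) • coordL (i + 1) - α ^ a • coordL (i - 1) := by
    apply clm_ext_delta
    intro j
    simp only [ContinuousLinearMap.comp_apply, sub_apply, smul_apply, coordL_apply, hB j,
      coord_sub, coord_smul, coord_delta, smul_eq_mul]
    congr 3 <;> (apply propext; constructor <;> intro h <;> omega)
  have := congrArg (fun f => f v) this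
  simpa [coordL_apply] using this

theorem coord_C_even {α : ℂ} {a : ℤ} {C : Op} (hC : IsCj α a C) (v : Hqw) (i : ℤ) :
    coord (C v) (2 * i) = α ^ (2 * a) * coord v (2 * i - 2) := by
  have : (coordL (2 * i)).comp C = α ^ (2 * a) • coordL (2 * i - 2) := by
    apply clm_ext_delta
    intro j
    rcases Int.even_or_odd' j with ⟨k, rfl | rfl⟩
    · simp only [ContinuousLinearMap.comp_apply, coordL_apply, (hC k).1,
        coord_smul, coord_delta, smul_eq_mul, smul_apply]
      congr 2
      apply propext; constructor <;> intro h <;> omega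
    · simp only [ContinuousLinearMap.comp_apply, coordL_apply, (hC k).2,
        coord_smul, coord_delta, smul_eq_mul, smul_apply]
      rw [if_neg (by omega), if_neg (by omega)]; simp
  have := congrArg (fun f => f v) this
  simpa [coordL_apply] using this

theorem coord_C_odd {α : ℂ} {a : ℤ} {C : Op} (hC : IsCj α a C) (v : Hqw) (i : ℤ) :
    coord (C v) (2 * i + 1) = α ^ (-(2 * a)) * coord v (2 * i + 3) := by
  have : (coordL (2 * i + 1)).comp C = α ^ (-(2 * a)) • coordL (2 * i + 3) := by
    apply clm_ext_delta
    intro j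
    rcases Int.even_or_odd' j with ⟨k, rfl | rfl⟩
    · simp only [ContinuousLinearMap.comp_apply, coordL_apply, (hC k).1,
        coord_smul, coord_delta, smul_eq_mul, smul_apply]
      rw [if_neg (by omega), if_neg (by omega)]; simp
    · simp only [ContinuousLinearMap.comp_apply, coordL_apply, (hC k).2,
        coord_smul, coord_delta, smul_eq_mul, smul_apply]
      congr 2
      apply propext; constructor <;> intro h <;> omega
  have := congrArg (fun f => f v) this
  simpa [coordL_apply] using this

/-- the factor attached to a pair (type, index) -/
def fac (Bf Cf : ℤ → Op) (x : Bool × ℤ) : Op := if x.1 = true then Cf x.2 else Bf x.2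

def wt (x : Bool × ℤ) : ℕ := if x.1 = true then 2 else 1

/-- band and parity structure of the products -/
theorem band {α : ℂ} {Bf Cf : ℤ → Op} (hBf : ∀ j : ℤ, IsBj α j (Bf j))
    (hCf : ∀ j : ℤ, IsCj α j (Cf j)) (L : List (Bool × ℤ)) (j : ℤ) : ∀ i : ℤ,
    ¬ (|i - j| ≤ ((L.map wt).sum : ℕ) ∧ Even (i - j - ((L.map wt).sum : ℕ))) →
    coord ((L.map (fac Bf Cf)).prod (δ j)) i = 0 := by
  induction L with
  | nil =>
    intro i h
    simp only [List.map_nil, List.prod_nil, one_apply_eq_self, coord_delta]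
    rw [if_neg]
    rintro rfl
    simp at h
  | cons x L ih =>
    intro i h
    obtain ⟨b, a⟩ := x
    simp only [List.map_cons, List.prod_cons, op_mul, List.sum_cons] at h ⊢
    generalize (L.map wt).sum = s at h ih
    cases b with
    | false =>
      simp only [fac, wt, Bool.false_eq_true, if_false, abs_le, Int.even_iff] at h ih ⊢
      rw [coord_B (hBf a), ih (i + 1) (by push_cast at h; omega),
        ih (i - 1) (by push_cast at h; omega)]
      simp
    | true =>
      simp only [fac, wt, if_true, abs_le, Int.even_iff] at h ih ⊢
      rcases Int.even_or_odd' i with ⟨k, rfl | rfl⟩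
      · rw [coord_C_even (hCf a), ih (2 * k - 2) (by push_cast at h; omega)]
        simp
      · rw [coord_C_odd (hCf a), ih (2 * k + 3) (by push_cast at h; omega)]
        simp

def flp (N : ℤ) (x : Bool × ℤ) : Bool × ℤ := (x.1, N - x.2)

/-- transposition symmetry of the products -/
theorem transp {α : ℂ} (h0 : α ≠ 0) {Bf Cf : ℤ → Op} (hBf : ∀ j : ℤ, IsBj α j (Bf j))
    (hCf : ∀ j : ℤ, IsCj α j (Cf j)) (N : ℤ) (L : List (Bool × ℤ)) : ∀ i j : ℤ,
    coord ((L.map (fac Bf Cf)).prod (δ j)) i = (-1) ^ (L.map wt).sum * (α ^ (N * (i - j)) *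
      coord ((L.reverse.map (fun x => fac Bf Cf (flp N x))).prod (δ (i + 1))) (j + 1)) := by
  induction L with
  | nil =>
    intro i j
    simp only [List.map_nil, List.prod_nil, one_apply_eq_self, coord_delta,
      List.reverse_nil, List.sum_nil]
    by_cases h : i = j
    · subst h; simp
    · rw [if_neg h, if_neg (by omega)]; simp
  | cons x L ih =>
    intro i j
    obtain ⟨b, a⟩ := x
    simp only [List.map_cons, List.prod_cons, op_mul, List.sum_cons,
      List.reverse_cons, List.map_append, List.prod_append, List.map_nil, List.prod_nil, mul_one]
    generalize (L.map wt).sum = s at ih ⊢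
    generalize (L.reverse.map (fun x => fac Bf Cf (flp N x))).prod = P at ih ⊢
    cases b with
    | false =>
      simp only [fac, wt, flp, Bool.false_eq_true, if_false]
      rw [coord_B (hBf a), ih, ih, hBf (N - a) (i + 1), map_sub, map_smul, map_smul, coord_sub,
        coord_smul, coord_smul]
      have e1 : α ^ (N * (i + 1 - j)) = α ^ (N * (i - j)) * α ^ N := by
        rw [← zpow_add₀ h0]; congr 1; ring
      have e2 : α ^ (N * (i - 1 - j)) = α ^ (N * (i - j)) * α ^ (-N) := by
        rw [← zpow_add₀ h0]; congr 1; ring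
      have e3 : α ^ (-(N - a)) = α ^ (-N) * α ^ a := by
        rw [← zpow_add₀ h0]; congr 1; ring
      have e4 : α ^ (N - a) = α ^ N * α ^ (-a) := by
        rw [← zpow_add₀ h0]; congr 1
      rw [e1, e2, e3, e4]
      have e5 : i - 1 + 1 = i + 1 - 1 := by ring
      rw [e5]
      ring
    | true =>
      simp only [fac, wt, flp, if_true]
      rcases Int.even_or_odd' i with ⟨k, rfl | rfl⟩
      · rw [coord_C_even (hCf a), ih, (hCf (N - a) k).2, map_smul, coord_smul]
        have e1 : α ^ (N * (2 * k - 2 - j)) = α ^ (N * (2 * k - j)) * α ^ (-(2 * N)) := by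
          rw [← zpow_add₀ h0]; congr 1; ring
        have e3 : α ^ (-(2 * (N - a))) = α ^ (-(2 * N)) * α ^ (2 * a) := by
          rw [← zpow_add₀ h0]; congr 1; ring
        rw [e1, e3]
        have e5 : 2 * k - 2 + 1 = 2 * k - 1 := by ring
        rw [e5]
        ring
      · have e6 : 2 * k + 1 + 1 = 2 * (k + 1) := by ring
        rw [coord_C_odd (hCf a), ih, e6, (hCf (N - a) (k + 1)).1, map_smul, coord_smul]
        have e1 : α ^ (N * (2 * k + 3 - j)) = α ^ (N * (2 * k + 1 - j)) * α ^ (2 * N) := by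
          rw [← zpow_add₀ h0]; congr 1; ring
        have e3 : α ^ (2 * (N - a)) = α ^ (2 * N) * α ^ (-(2 * a)) := by
          rw [← zpow_add₀ h0]; congr 1; ring
        rw [e1, e3]
        have e5 : 2 * k + 3 + 1 = 2 * (k + 1) + 2 := by ring
        rw [e5]
        ring

/-- list attached to a summation index -/
def lst {n l : ℕ} (p : (Fin l → Fin n) × (Fin l → Bool)) : List (Bool × ℤ) :=
  List.ofFn fun k => (p.2 k, ((p.1 k : ℕ) : ℤ))

theorem lst_prod {n l : ℕ} (Bf Cf : ℤ → Op) (p : (Fin l → Fin n) × (Fin l → Bool)) :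
    (List.ofFn fun k : Fin l =>
        if p.2 k = true then Cf ((p.1 k : ℕ) : ℤ) else Bf ((p.1 k : ℕ) : ℤ)).prod =
      ((lst p).map (fac Bf Cf)).prod := by
  rw [lst, List.map_ofFn]
  rfl

theorem lst_wt {n l : ℕ} (p : (Fin l → Fin n) × (Fin l → Bool)) :
    ((lst p).map wt).sum = l + (Finset.univ.filter fun k => p.2 k = true).card := by
  rw [lst, List.map_ofFn, List.sum_ofFn, Finset.card_filter]
  have : ∀ k, (wt ∘ fun k => (p.2 k, ((p.1 k : ℕ) : ℤ))) k = 1 + if p.2 k = true then 1 else 0 := by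
    intro k
    simp only [Function.comp, wt]
    split_ifs <;> rfl
  simp only [this, Finset.sum_add_distrib]
  simp

/-- reversal of the summation index -/
def rv {n l : ℕ} (p : (Fin l → Fin n) × (Fin l → Bool)) : (Fin l → Fin n) × (Fin l → Bool) :=
  (fun k => (p.1 k.rev).rev, fun k => p.2 k.rev)

theorem rv_rv {n l : ℕ} (p : (Fin l → Fin n) × (Fin l → Bool)) : rv (rv p) = p := by
  simp [rv]

def rvE (n l : ℕ) : Equiv.Perm ((Fin l → Fin n) × (Fin l → Bool)) := ⟨rv, rv, rv_rv, rv_rv⟩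

theorem rv_mono {n l : ℕ} {p : (Fin l → Fin n) × (Fin l → Bool)} (h : StrictMono p.1) :
    StrictMono (rv p).1 := by
  intro a b hab
  exact Fin.rev_lt_rev.2 (h (Fin.rev_lt_rev.2 hab))

theorem rv_card {n l : ℕ} (p : (Fin l → Fin n) × (Fin l → Bool)) :
    (Finset.univ.filter fun k => (rv p).2 k = true).card =
      (Finset.univ.filter fun k => p.2 k = true).card := by
  rw [Finset.card_filter, Finset.card_filter]
  exact Equiv.sum_comp Fin.revPerm (fun k => if p.2 k = true then 1 else 0)

theorem rv_lst {n l : ℕ} (p : (Fin l → Fin n) × (Fin l → Bool)) :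
    (lst p).reverse.map (flp ((n : ℤ) - 1)) = lst (rv p) := by
  apply List.ext_getElem
  · simp [lst]
  · intro i h1 h2
    simp only [lst, List.length_ofFn] at h2
    simp only [lst, List.getElem_map, List.getElem_reverse, List.getElem_ofFn, flp, rv,
      List.length_ofFn]
    have e : (⟨l - 1 - i, by omega⟩ : Fin l) = Fin.rev ⟨i, h2⟩ := by
      ext; simp only [Fin.val_rev]; omega
    rw [e]
    ext
    · rfl
    · simp only [Fin.val_rev]
      have := (p.1 (Fin.rev ⟨i, h2⟩)).2
      omega

def cnd {n l : ℕ} (m : ℕ) (p : (Fin l → Fin n) × (Fin l → Bool)) : Prop :=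
  StrictMono p.1 ∧ (∀ k, 0 ≤ (p.1 k : ℕ)) ∧
        (Finset.univ.filter fun k => p.2 k = true).card = m

theorem rv_cnd {n l m : ℕ} (p : (Fin l → Fin n) × (Fin l → Bool)) :
    cnd m (rv p) ↔ cnd m p := by
  have : ∀ q : (Fin l → Fin n) × (Fin l → Bool), cnd m q → cnd m (rv q) := fun q h =>
    ⟨rv_mono h.1, fun _ => Nat.zero_le _, (rv_card q).trans h.2.2⟩
  refine ⟨fun h => ?_, this p⟩
  have := this _ h
  rwa [rv_rv] at this

open Classical in
theorem Sop_coord (Bf Cf : ℤ → Op) (n l m : ℕ) (i j : ℤ) :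
    coord (Sop Bf Cf 0 n l m (δ j)) i = ∑ p : (Fin l → Fin n) × (Fin l → Bool),
      if cnd m p then coord (((lst p).map (fac Bf Cf)).prod (δ j)) i else 0 := by
  rw [← coordL_apply, Sop, sum_apply, map_sum]
  refine Finset.sum_congr rfl fun p _ => ?_
  simp only [← lst_prod]
  unfold cnd
  split_ifs
  · rfl
  · simp

theorem Sop_band {α : ℂ} {Bf Cf : ℤ → Op} (hBf : ∀ j : ℤ, IsBj α j (Bf j))
    (hCf : ∀ j : ℤ, IsCj α j (Cf j)) (n l m : ℕ) (i j : ℤ)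
    (h : ¬ (|i - j| ≤ ((l + m : ℕ) : ℤ) ∧ Even (i - j - ((l + m : ℕ) : ℤ)))) :
    coord (Sop Bf Cf 0 n l m (δ j)) i = 0 := by
  rw [Sop_coord]
  refine Finset.sum_eq_zero fun p _ => ?_
  split_ifs with hp
  · apply band hBf hCf
    rwa [lst_wt, hp.2.2]
  · rfl

theorem Sop_transp {α : ℂ} (h0 : α ≠ 0) {Bf Cf : ℤ → Op} (hBf : ∀ j : ℤ, IsBj α j (Bf j))
    (hCf : ∀ j : ℤ, IsCj α j (Cf j)) (n l m : ℕ) (i j : ℤ) :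
    coord (Sop Bf Cf 0 n l m (δ j)) i = (-1) ^ (l + m) * (α ^ (((n : ℤ) - 1) * (i - j)) *
      coord (Sop Bf Cf 0 n l m (δ (i + 1))) (j + 1)) := by
  classical
  rw [Sop_coord, Sop_coord, Finset.mul_sum, Finset.mul_sum]
  refine Fintype.sum_equiv (rvE n l) _ _ fun p => ?_
  have e : (rvE n l) p = rv p := rfl
  rw [e]
  by_cases hp : cnd m p
  · rw [if_pos hp, if_pos ((rv_cnd p).2 hp), transp h0 hBf hCf ((n : ℤ) - 1), lst_wt,
      hp.2.2, ← rv_lst p, List.map_map]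
    rfl
  · rw [if_neg hp, if_neg (mt (rv_cnd p).1 hp)]; simp

theorem adm_prim {n : ℕ} (hn : 0 < n) {α : ℂ} (hα : IsAdmissible n α) : IsPrimitiveRoot α n := by
  obtain ⟨-, k, -, hk, rfl⟩ := hα
  have := Complex.isPrimitiveRoot_exp_of_coprime k n hn.ne' hk
  convert this using 2
  push_cast
  ring

/-- Lemma 5.1: if `0 ≤ m ≤ ℓ ≤ n`, `ℓ + m < n`, and
`S^{ℓ,m}_{[0,n-1]}` commutes with `D_n`, then it is a constant multiple of the
identity; moreover if `ℓ - m` is odd then `S^{ℓ,m}_{[0,n-1]} = 0`. -/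
theorem stmt13 (n : ℕ) (hn : 0 < n) (α : ℂ) (hα : IsAdmissible n α)
    (Bf Cf : ℤ → Op) (hBf : ∀ j : ℤ, IsBj α j (Bf j)) (hCf : ∀ j : ℤ, IsCj α j (Cf j))
    (D : Op) (hD : IsDn α D)
    (l m : ℕ) (hm : m ≤ l) (hl : l ≤ n) (hlm : l + m < n)
    (hcomm : Sop Bf Cf 0 n l m * D = D * Sop Bf Cf 0 n l m) :
    (∃ γ : ℂ, Sop Bf Cf 0 n l m = γ • (1 : Op)) ∧
      (Odd (l - m) → Sop Bf Cf 0 n l m = 0) := by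
  have hprim := adm_prim hn hα
  have h0 : α ≠ 0 := hprim.ne_zero hn.ne'
  set S := Sop Bf Cf 0 n l m with hS
  have hDc : ∀ (v : Hqw) (i : ℤ), coord (D v) i = α ^ i * coord v i := by
    intro v i
    have : (coordL i).comp D = α ^ i • coordL i := by
      apply clm_ext_delta
      intro j
      simp only [ContinuousLinearMap.comp_apply, coordL_apply, hD j,
        coord_smul, coord_delta, smul_eq_mul, smul_apply]
      by_cases h : i = j
      · subst h; rfl
      · simp [h]
    have := congrArg (fun f => f v) this
    simpa [coordL_apply] using this
  have hoff : ∀ i j : ℤ, i ≠ j → coord (S (δ j)) i = 0 := by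
    intro i j hij
    by_cases hb : |i - j| ≤ ((l + m : ℕ) : ℤ)
    · have h1 := congrArg (fun T : Op => coord (T (δ j)) i) hcomm
      simp only [op_mul, hDc, hD j, map_smul, coord_smul] at h1
      by_contra hne
      have h2 := mul_right_cancel₀ hne h1
      have h3 : α ^ (i - j) = 1 := by
        rw [zpow_sub₀ h0, h2]
        exact div_self (zpow_ne_zero _ h0)
      rw [hprim.zpow_eq_one_iff_dvd] at h3
      have := Int.le_of_dvd (abs_pos.2 (sub_ne_zero.2 hij)) ((dvd_abs _ _).2 h3)
      push_cast at hb
      omega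
    · exact Sop_band hBf hCf n l m i j (fun h => hb h.1)
  have hstep : ∀ i : ℤ, coord (S (δ i)) i = (-1) ^ (l + m) * coord (S (δ (i + 1))) (i + 1) := by
    intro i
    have := Sop_transp h0 hBf hCf n l m i i
    simpa using this
  have hodd : Odd (l - m) → S = 0 := by
    intro ho
    apply clm_ext_delta
    intro j
    apply coord_ext
    intro i
    change coord (S (δ j)) i = 0
    by_cases hij : i = j
    · subst hij
      apply Sop_band hBf hCf n l m i i
      rintro ⟨-, h⟩
      rw [Int.even_iff] at h
      rw [Nat.odd_iff] at ho
      push_cast at h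
      omega
    · exact hoff i j hij
  refine ⟨?_, hodd⟩
  by_cases ho : Odd (l - m)
  · exact ⟨0, by rw [hodd ho, zero_smul]⟩
  · have he : Even (l + m) := by
      rw [Nat.odd_iff] at ho
      rw [Nat.even_iff]
      omega
    have hconst : ∀ i : ℤ, coord (S (δ i)) i = coord (S (δ 0)) 0 := by
      simp only [he.neg_one_pow, one_mul] at hstep
      intro i
      induction i using Int.induction_on with
      | zero => rfl
      | succ k ih => rw [← hstep, ih]
      | pred k ih => rw [hstep, ← ih]; congr 2 <;> simp
    refine ⟨coord (S (δ 0)) 0, ?_⟩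
    apply clm_ext_delta
    intro j
    apply coord_ext
    intro i
    simp only [smul_apply, one_apply_eq_self, coord_smul,
      coord_delta]
    by_cases hij : i = j
    · subst hij
      rw [hconst]; simp
    · rw [hoff i j hij, if_neg hij, mul_zero]
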